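/- Let H be a real Hilbert space, C ⊆ H a nonempty convex subset, T : C → C an L-Lipschitzian pseudo-contraction (L > 0), (αₙ), (βₙ) sequences in [0,1] with αₙ ≤ βₙ for all n and lim βₙ = 0, β a rate of convergence of (βₙ), K := β(⌈1 + √(2L² + 4)⌉), and θ a rate of divergence of the series ∑ₙ α_{n+K}β_{n+K}. Let (xₙ) be the Ishikawa iteration starting at some x ∈ C. Suppose p ∈ C is a fixed point of T and b ∈ ℕ satisfies ‖x_K − p‖ ≤ b. Then for all l, k ∈ ℕ, setting k' := ⌈(1 + L)(1 + k)⌉, there exists N with l ≤ N ≤ K + θ(l + 2(b² + 1)(k' + 1)²) such that ‖x_N − x_{N+1}‖ ≤ 1/(k+1); i.e., Δ̂(l,k) := K + θ(l + 2(b² + 1)(k' + 1)²) is a modulus of liminf for (‖xₙ − xₙ₊₁‖). -/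

import Mathlib

theorem norm_sq_convex_comb {H : Type*} [NormedAddCommGroup H] [InnerProductSpace ℝ H]
    (u v w : H) (t : ℝ) :
    ‖t • v + (1 - t) • u - w‖ ^ 2 =
      (1 - t) * ‖u - w‖ ^ 2 + t * ‖v - w‖ ^ 2 - t * (1 - t) * ‖u - v‖ ^ 2 := by
  have h1 : t • v + (1 - t) • u - w = t • (v - w) + (1 - t) • (u - w) := by module
  have h2 : u - v = (u - w) - (v - w) := by abel
  rw [h1, h2, norm_add_sq_real, norm_sub_sq_real (u - w), norm_smul, norm_smul, inner_smul_left,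
    inner_smul_right, real_inner_comm, mul_pow, mul_pow, Real.norm_eq_abs, Real.norm_eq_abs,
    sq_abs, sq_abs]
  simp only [conj_trivial]
  ring

/-- The basic descent inequality for one step of the Ishikawa iteration. -/
theorem ishikawa_step_norm_sq_le {H : Type*} [NormedAddCommGroup H] [InnerProductSpace ℝ H]
    {C : Set H} {T : H → H} {L : ℝ}
    (hLip : ∀ c ∈ C, ∀ d ∈ C, ‖T c - T d‖ ≤ L * ‖c - d‖)
    (hPC : ∀ c ∈ C, ∀ d ∈ C,
      ‖T c - T d‖ ^ 2 ≤ ‖c - d‖ ^ 2 + ‖(c - T c) - (d - T d)‖ ^ 2)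
    {a s : ℝ} (ha : 0 ≤ a) (hs : 0 ≤ s) (has : a ≤ s)
    {x y z p : H} (hx : x ∈ C) (hyC : y ∈ C) (hp : p ∈ C) (hfix : T p = p)
    (hy : y = s • T x + (1 - s) • x) (hz : z = a • T y + (1 - a) • x) :
    ‖z - p‖ ^ 2 ≤
      ‖x - p‖ ^ 2 - a * s * (1 - 2 * s - L ^ 2 * s ^ 2) * ‖x - T x‖ ^ 2 := by
  have e1 := norm_sq_convex_comb x (T y) p a
  rw [← hz] at e1
  have e2 := norm_sq_convex_comb x (T x) p s
  rw [← hy] at e2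
  have e3 := norm_sq_convex_comb x (T x) (T y) s
  rw [← hy] at e3
  have i1 := hPC y hyC p hp
  have i2 := hPC x hx p hp
  rw [hfix, sub_self, sub_zero] at i1 i2
  have hxy : ‖x - y‖ = s * ‖x - T x‖ := by
    have : x - y = s • (x - T x) := by rw [hy]; module
    rw [this, norm_smul, Real.norm_of_nonneg hs]
  have i3 : ‖T x - T y‖ ^ 2 ≤ L ^ 2 * s ^ 2 * ‖x - T x‖ ^ 2 := by
    have := pow_le_pow_left₀ (norm_nonneg _) (hLip x hx y hyC) 2
    rw [hxy] at this
    linarith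
  have j2 := mul_le_mul_of_nonneg_left i2 hs
  have j3 := mul_le_mul_of_nonneg_left i3 hs
  have hTy : ‖T y - p‖ ^ 2 ≤ ‖x - p‖ ^ 2
      - s * (1 - 2 * s - L ^ 2 * s ^ 2) * ‖x - T x‖ ^ 2 + (1 - s) * ‖x - T y‖ ^ 2 := by
    nlinarith
  have j1 := mul_le_mul_of_nonneg_left hTy ha
  have j4 : 0 ≤ a * (s - a) * ‖x - T y‖ ^ 2 :=
    mul_nonneg (mul_nonneg ha (sub_nonneg.2 has)) (sq_nonneg _)
  rw [e1]
  linarith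

theorem half_le_one_sub_two_mul_sub_sq {L s : ℝ} (hs : 0 ≤ s)
    (h : s ≤ 1 / (2 + Real.sqrt (2 * L ^ 2 + 4))) :
    1 / 2 ≤ 1 - 2 * s - L ^ 2 * s ^ 2 := by
  set r := Real.sqrt (2 * L ^ 2 + 4) with hr
  have hr0 : 0 ≤ r := Real.sqrt_nonneg _
  have hr2 : r ^ 2 = 2 * L ^ 2 + 4 := Real.sq_sqrt (by positivity)
  have h1 : s * (2 + r) ≤ 1 := (le_div_iff₀ (by positivity)).1 h
  have hL : L ^ 2 = (r ^ 2 - 4) / 2 := by linarith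
  rw [hL]
  -- the claim factors as `0 ≤ (1 - s * (2 + r)) * (1 + s * (r - 2))`
  have hL0 : 0 ≤ L ^ 2 := sq_nonneg L
  have h2 : 2 ≤ r := by nlinarith
  have h3 : 0 ≤ (1 - s * (2 + r)) * (1 + s * (r - 2)) :=
    mul_nonneg (by linarith) (by nlinarith)
  nlinarith

/-- Partial sums of `f` dominated by the decrease of a nonnegative sequence stay bounded. -/
theorem sum_range_le_of_add_le {f u : ℕ → ℝ} (hu : ∀ n, 0 ≤ u n)
    (h : ∀ n, u (n + 1) + f n ≤ u n) (m : ℕ) : ∑ i ∈ Finset.range m, f i ≤ u 0 := by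
  have : ∑ i ∈ Finset.range m, f i ≤ ∑ i ∈ Finset.range m, (u i - u (i + 1)) :=
    Finset.sum_le_sum fun i _ => by linarith [h i]
  rw [Finset.sum_range_sub'] at this
  linarith [hu m]

theorem exists_le_one_div_of_sum_mul_sq_le {w d : ℕ → ℝ} (hw0 : ∀ i, 0 ≤ w i) (hw1 : ∀ i, w i ≤ 1)
    {B c : ℝ} (hc : 0 < c) {l m : ℕ}
    (hsum : ∑ i ∈ Finset.range m, w i * d i ^ 2 ≤ B)
    (hdiv : (l : ℝ) + c ^ 2 * B < ∑ i ∈ Finset.range m, w i) :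
    ∃ i, l ≤ i ∧ i < m ∧ d i ≤ 1 / c := by
  by_contra! hcon
  have hterm : ∀ i ∈ Finset.range m,
      w i ≤ (if i < l then 1 else 0) + c ^ 2 * (w i * d i ^ 2) := by
    intro i hi
    split_ifs with hil
    · have hwi := hw0 i
      have : 0 ≤ c ^ 2 * (w i * d i ^ 2) := by positivity
      linarith [hw1 i]
    · have h1 : 1 < d i * c :=
        (div_lt_iff₀ hc).1 (hcon i (not_lt.1 hil) (Finset.mem_range.1 hi))
      have h2 : 1 ≤ (d i * c) ^ 2 := one_le_pow₀ h1.le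
      nlinarith [mul_le_mul_of_nonneg_left h2 (hw0 i)]
  have hcard : ∑ i ∈ Finset.range m, (if i < l then (1 : ℝ) else 0) ≤ l := by
    rw [Finset.sum_boole]
    have : ((Finset.range m).filter (· < l)).card ≤ (Finset.range l).card :=
      Finset.card_le_card fun i hi => Finset.mem_range.2 (Finset.mem_filter.1 hi).2
    rw [Finset.card_range] at this
    exact_mod_cast this
  have := Finset.sum_le_sum hterm
  rw [Finset.sum_add_distrib, ← Finset.mul_sum] at this
  have := mul_le_mul_of_nonneg_left hsum (sq_nonneg c)
  linarith


/-- with `k' := ⌈(1 + L)(1 + k)⌉`, the function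
`Δ̂(l,k) := K + θ(l + 2(b² + 1)(k' + 1)²)` is a modulus of liminf for `(‖xₙ − xₙ₊₁‖)`. -/
theorem ishikawa_modulus_liminf_consecutive
    {H : Type*} [NormedAddCommGroup H] [InnerProductSpace ℝ H]
    (C : Set H) (hCne : C.Nonempty) (hCconv : Convex ℝ C)
    (T : H → H) (hTmap : ∀ c ∈ C, T c ∈ C)
    (L : ℝ) (hL : 0 < L)
    (hLip : ∀ c ∈ C, ∀ d ∈ C, ‖T c - T d‖ ≤ L * ‖c - d‖)
    (hPC : ∀ c ∈ C, ∀ d ∈ C,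
      ‖T c - T d‖ ^ 2 ≤ ‖c - d‖ ^ 2 + ‖(c - T c) - (d - T d)‖ ^ 2)
    (α β : ℕ → ℝ)
    (hα : ∀ n, α n ∈ Set.Icc (0 : ℝ) 1) (hβmem : ∀ n, β n ∈ Set.Icc (0 : ℝ) 1)
    (hA3 : ∀ n, α n ≤ β n)
    (hβ0 : Filter.Tendsto β Filter.atTop (nhds 0))
    (ρ : ℕ → ℕ) (hρ : ∀ k : ℕ, ∀ n : ℕ, ρ k ≤ n → β n ≤ 1 / ((k : ℝ) + 1))
    (K : ℕ) (hK : K = ρ ⌈1 + Real.sqrt (2 * L ^ 2 + 4)⌉₊)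
    (θ : ℕ → ℕ)
    (hθ : ∀ n : ℕ, (n : ℝ) ≤ ∑ i ∈ Finset.range (θ n + 1), α (i + K) * β (i + K))
    (x₀ : H) (hx₀ : x₀ ∈ C)
    (x y : ℕ → H) (hx0 : x 0 = x₀)
    (hy : ∀ n, y n = β n • T (x n) + (1 - β n) • x n)
    (hxs : ∀ n, x (n + 1) = α n • T (y n) + (1 - α n) • x n)
    (p : H) (hp : p ∈ C) (hfix : T p = p)
    (b : ℕ) (hb : ‖x K - p‖ ≤ (b : ℝ)) :
    ∀ l k : ℕ, ∃ N : ℕ,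
      l ≤ N ∧
      N ≤ K + θ (l + 2 * (b ^ 2 + 1) * (⌈(1 + L) * (1 + (k : ℝ))⌉₊ + 1) ^ 2) ∧
      ‖x N - x (N + 1)‖ ≤ 1 / ((k : ℝ) + 1) := by
  have hcomb : ∀ {t : ℝ}, t ∈ Set.Icc (0 : ℝ) 1 → ∀ {u v : H}, u ∈ C → v ∈ C →
      t • u + (1 - t) • v ∈ C := fun ht _ _ hu hv =>
    hCconv hu hv ht.1 (sub_nonneg.2 ht.2) (by ring)
  have hyC_of : ∀ n, x n ∈ C → y n ∈ C := fun n hn => by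
    rw [hy]; exact hcomb (hβmem n) (hTmap _ hn) hn
  have hxC : ∀ n, x n ∈ C := by
    intro n
    induction n with
    | zero => rwa [hx0]
    | succ n ih => rw [hxs]; exact hcomb (hα n) (hTmap _ (hyC_of n ih)) ih
  have hyC : ∀ n, y n ∈ C := fun n => hyC_of n (hxC n)
  have hβhalf : ∀ n, K ≤ n → 1 / 2 ≤ 1 - 2 * β n - L ^ 2 * β n ^ 2 := by
    intro n hn
    refine half_le_one_sub_two_mul_sub_sq (hβmem n).1 ((hρ _ n (hK ▸ hn)).trans ?_)
    have := Nat.le_ceil (1 + Real.sqrt (2 * L ^ 2 + 4))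
    exact one_div_le_one_div_of_le (by positivity) (by linarith)
  have hαβ : ∀ n, 0 ≤ α n * β n := fun n => mul_nonneg (hα n).1 (hβmem n).1
  have hdesc : ∀ i, 2 * ‖x (i + 1 + K) - p‖ ^ 2
      + α (i + K) * β (i + K) * ‖x (i + K) - T (x (i + K))‖ ^ 2
      ≤ 2 * ‖x (i + K) - p‖ ^ 2 := by
    intro i
    have h1 := ishikawa_step_norm_sq_le hLip hPC (hα (i + K)).1 (hβmem (i + K)).1
      (hA3 (i + K)) (hxC _) (hyC _) hp hfix (hy _) (hxs (i + K))
    have h2 := mul_le_mul_of_nonneg_left (hβhalf (i + K) (Nat.le_add_left _ _))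
      (mul_nonneg (hαβ (i + K)) (sq_nonneg ‖x (i + K) - T (x (i + K))‖))
    rw [Nat.add_right_comm]
    linarith
  have hstep : ∀ n, ‖x n - x (n + 1)‖ ≤ (1 + L) * ‖x n - T (x n)‖ := by
    intro n
    have e1 : x n - x (n + 1) = α n • ((x n - T (x n)) + (T (x n) - T (y n))) := by
      rw [hxs]; module
    have e2 : x n - y n = β n • (x n - T (x n)) := by rw [hy]; module
    have h1 := hLip _ (hxC n) _ (hyC n)
    rw [e2, norm_smul, Real.norm_of_nonneg (hβmem n).1] at h1
    have h2 : L * (β n * ‖x n - T (x n)‖) ≤ L * ‖x n - T (x n)‖ :=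
      mul_le_mul_of_nonneg_left (mul_le_of_le_one_left (norm_nonneg _) (hβmem n).2) hL.le
    rw [e1, norm_smul, Real.norm_of_nonneg (hα n).1]
    refine (mul_le_of_le_one_left (norm_nonneg _) (hα n).2).trans ?_
    linarith [norm_add_le (x n - T (x n)) (T (x n) - T (y n))]
  intro l k
  set k' := ⌈(1 + L) * (1 + (k : ℝ))⌉₊ with hk'
  have hk'le : (1 + L) * (1 + (k : ℝ)) ≤ k' := Nat.le_ceil _
  set M := l + 2 * (b ^ 2 + 1) * (k' + 1) ^ 2 with hM
  have hsum : ∑ i ∈ Finset.range (θ M + 1),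
      α (i + K) * β (i + K) * ‖x (i + K) - T (x (i + K))‖ ^ 2 ≤ 2 * (b : ℝ) ^ 2 := by
    refine (sum_range_le_of_add_le (u := fun i => 2 * ‖x (i + K) - p‖ ^ 2)
      (fun _ => by positivity) hdesc _).trans ?_
    simp only [Nat.zero_add]
    gcongr
  have hdiv : (l : ℝ) + ((k' : ℝ) + 1) ^ 2 * (2 * (b : ℝ) ^ 2)
      < ∑ i ∈ Finset.range (θ M + 1), α (i + K) * β (i + K) := by
    refine lt_of_lt_of_le ?_ (hθ M)
    rw [hM]
    push_cast
    have : 0 < ((k' : ℝ) + 1) ^ 2 := by positivity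
    linarith
  obtain ⟨i, hli, him, hi⟩ := exists_le_one_div_of_sum_mul_sq_le (fun i => hαβ (i + K))
    (fun i => mul_le_one₀ (hα (i + K)).2 (hβmem (i + K)).1 (hβmem (i + K)).2)
    (d := fun i => ‖x (i + K) - T (x (i + K))‖) (by positivity) hsum hdiv
  refine ⟨i + K, by omega, by omega, (hstep (i + K)).trans ?_⟩
  rw [le_div_iff₀ (by positivity)] at hi ⊢
  have := norm_nonneg (x (i + K) - T (x (i + K)))
  nlinarith [mul_le_mul_of_nonneg_left hk'le this]
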